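/- For every integer n ≥ 2, the polynomial S_n satisfies the second-order linear differential equation 𝔓_{2,n}(x) S_n″(x) + 𝔓_{1,n}(x) S_n′(x) + 𝔓_{0,n}(x) S_n(x) = 0, where 𝔓_{2,n} = q_{1,n} q_{0,n}², 𝔓_{1,n} = q_{0,n} ( q_{1,n} q_{2,n} + q_{1,n} q_{3,n} + q_{0,n}′ q_{1,n} − q_{0,n} q_{1,n}′ ), and 𝔓_{0,n} = q_{1,n} q_{2,n} q_{3,n} + q_{0,n} ( q_{2,n}′ q_{1,n} − q_{2,n} q_{1,n}′ ) − q_{4,n} q_{1,n}²; moreover, for n ≥ d+1, deg 𝔓_{2,n} = 6d+4, deg 𝔓_{1,n} ≤ 6d+3 and deg 𝔓_{0,n} ≤ 6d+2. -/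

import Mathlib

open Polynomial MeasureTheory Finset

noncomputable section

/-- The `k`-th derivative of a real polynomial. -/
def iterDeriv (k : ℕ) (f : Polynomial ℝ) : Polynomial ℝ := Polynomial.derivative^[k] f

/-- The Jacobi measure `dμ^{α,β}(x) = (1-x)^α (1+x)^β dx` on `[-1,1]`. -/
def jacobiMeasure (α β : ℝ) : Measure ℝ :=
  (volume.restrict (Set.Icc (-1 : ℝ) 1)).withDensity
    fun x => ENNReal.ofReal ((1 - x) ^ α * (1 + x) ^ β)

/-- The Jacobi–Sobolev inner product
`⟨f,g⟩_S = ∫ f g dμ^{α,β} + ∑_{j=1}^N ∑_{k=0}^{d_j} λ_{j,k} f^{(k)}(c_j) g^{(k)}(c_j)`. -/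
def sobolevIP (α β : ℝ) {N : ℕ} (c : Fin N → ℝ) (dd : Fin N → ℕ)
    (lam : Fin N → ℕ → ℝ) (f g : Polynomial ℝ) : ℝ :=
  (∫ x, f.eval x * g.eval x ∂(jacobiMeasure α β)) +
    ∑ j : Fin N, ∑ k ∈ Finset.range (dd j + 1),
      lam j k * (iterDeriv k f).eval (c j) * (iterDeriv k g).eval (c j)

/-- The degree-`k` Taylor polynomial of `f` centred at `c`:
`Q_k(x,c;f) = ∑_{ν=0}^k f^{(ν)}(c)(x-c)^ν/ν!` (as a polynomial in `x`). -/
def taylorPoly (k : ℕ) (c : ℝ) (f : Polynomial ℝ) : Polynomial ℝ :=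
  ∑ ν ∈ Finset.range (k + 1),
    Polynomial.C ((iterDeriv ν f).eval c / Nat.factorial ν) * (X - Polynomial.C c) ^ ν

/-- `ρ(x) = ∏_{j=1}^N (x-c_j)^{d_j+1}`. -/
def rhoPoly {N : ℕ} (c : Fin N → ℝ) (dd : Fin N → ℕ) : Polynomial ℝ :=
  ∏ j : Fin N, (X - Polynomial.C (c j)) ^ (dd j + 1)

/-- `ρ_{j,k}(x) = ρ(x)/(x-c_j)^{k+1} = (x-c_j)^{d_j-k} ∏_{i≠j} (x-c_i)^{d_i+1}`. -/
def rhoJK {N : ℕ} (c : Fin N → ℝ) (dd : Fin N → ℕ) (j : Fin N) (k : ℕ) : Polynomial ℝ :=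
  (X - Polynomial.C (c j)) ^ (dd j - k) *
    ∏ i ∈ Finset.univ.erase j, (X - Polynomial.C (c i)) ^ (dd i + 1)

/-- `â_n(x) = -n((2n+α+β)x+β-α)/(2n+α+β)`. -/
def ahat (α β : ℝ) (n : ℕ) : Polynomial ℝ :=
  Polynomial.C (-(n : ℝ) / (2 * (n : ℝ) + α + β)) *
    (Polynomial.C (2 * (n : ℝ) + α + β) * X + Polynomial.C (β - α))

/-- `b̂_n = 4n(n+α)(n+β)(n+α+β)/((2n+α+β)²(2n+α+β-1))`. -/
def bhat (α β : ℝ) (n : ℕ) : ℝ :=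
  4 * (n : ℝ) * ((n : ℝ) + α) * ((n : ℝ) + β) * ((n : ℝ) + α + β) /
    ((2 * (n : ℝ) + α + β) ^ 2 * (2 * (n : ℝ) + α + β - 1))

/-- `ĉ_n(x) = (n+α+β)((2n+α+β)x+α-β)/(2n+α+β)`. -/
def chat (α β : ℝ) (n : ℕ) : Polynomial ℝ :=
  Polynomial.C (((n : ℝ) + α + β) / (2 * (n : ℝ) + α + β)) *
    (Polynomial.C (2 * (n : ℝ) + α + β) * X + Polynomial.C (α - β))

/-- `d̂_n = -(2n+α+β-1)`. -/
def dhat (α β : ℝ) (n : ℕ) : ℝ := -(2 * (n : ℝ) + α + β - 1)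

/-- `γ_{1,n} = (β²-α²)/((2n+α+β)(2n+α+β+2))`. -/
def gamma1 (α β : ℝ) (n : ℕ) : ℝ :=
  (β ^ 2 - α ^ 2) / ((2 * (n : ℝ) + α + β) * (2 * (n : ℝ) + α + β + 2))

/-- `γ_{2,n} = 4n(n+α)(n+β)(n+α+β)/((2n+α+β)²((2n+α+β)²-1))`. -/
def gamma2 (α β : ℝ) (n : ℕ) : ℝ :=
  4 * (n : ℝ) * ((n : ℝ) + α) * ((n : ℝ) + β) * ((n : ℝ) + α + β) /
    ((2 * (n : ℝ) + α + β) ^ 2 * ((2 * (n : ℝ) + α + β) ^ 2 - 1))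


theorem intervalIntegrable_jacobiWeight {α β : ℝ} (hα : -1 < α) (hβ : -1 < β) :
    IntervalIntegrable (fun x : ℝ => (1 - x) ^ α * (1 + x) ^ β) volume (-1) 1 := by
  have left : IntervalIntegrable (fun x : ℝ => (1 - x) ^ α * (1 + x) ^ β) volume (-1) 0 := by
    refine IntervalIntegrable.continuousOn_mul ?_ ?_
    · have := (intervalIntegral.intervalIntegrable_rpow' (a := 0) (b := 1) hβ).comp_add_left 1
      simpa using this
    · refine ContinuousOn.rpow_const (by fun_prop) fun x hx => Or.inl ?_
      rw [Set.uIcc_of_le (by norm_num)] at hx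
      linarith [hx.2]
  have right : IntervalIntegrable (fun x : ℝ => (1 - x) ^ α * (1 + x) ^ β) volume 0 1 := by
    refine IntervalIntegrable.mul_continuousOn ?_ ?_
    · have := (intervalIntegral.intervalIntegrable_rpow' (a := 1) (b := 0) hα).comp_sub_left 1
      simpa using this
    · refine ContinuousOn.rpow_const (by fun_prop) fun x hx => Or.inl ?_
      rw [Set.uIcc_of_le (by norm_num)] at hx
      linarith [hx.1]
  exact left.trans right

theorem intervalIntegrable_jacobiWeight_mul {α β : ℝ} (hα : -1 < α) (hβ : -1 < β)
    (f : ℝ[X]) :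
    IntervalIntegrable (fun x : ℝ => (1 - x) ^ α * (1 + x) ^ β * f.eval x) volume (-1) 1 :=
  (intervalIntegrable_jacobiWeight hα hβ).mul_continuousOn f.continuous.continuousOn

theorem measurable_jacobiDensity (α β : ℝ) :
    Measurable fun x : ℝ => ENNReal.ofReal ((1 - x) ^ α * (1 + x) ^ β) := by
  fun_prop

theorem jacobiDensity_toReal {α β x : ℝ} (hx : x ∈ Set.Icc (-1 : ℝ) 1) :
    (ENNReal.ofReal ((1 - x) ^ α * (1 + x) ^ β)).toReal = (1 - x) ^ α * (1 + x) ^ β :=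
  ENNReal.toReal_ofReal (mul_nonneg (Real.rpow_nonneg (by linarith [hx.2]) _)
    (Real.rpow_nonneg (by linarith [hx.1]) _))

theorem integral_jacobiMeasure (α β : ℝ) (f : ℝ → ℝ) :
    ∫ x, f x ∂(jacobiMeasure α β) = ∫ x in (-1 : ℝ)..1, (1 - x) ^ α * (1 + x) ^ β * f x := by
  rw [jacobiMeasure, integral_withDensity_eq_integral_toReal_smul (measurable_jacobiDensity α β)
    (by simp), intervalIntegral.integral_of_le (by norm_num), ← integral_Icc_eq_integral_Ioc]
  refine setIntegral_congr_fun measurableSet_Icc fun x hx => ?_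
  simp only [jacobiDensity_toReal hx, smul_eq_mul]

theorem integrable_jacobiMeasure_eval {α β : ℝ} (hα : -1 < α) (hβ : -1 < β) (f : ℝ[X]) :
    Integrable (fun x => f.eval x) (jacobiMeasure α β) := by
  rw [jacobiMeasure, integrable_withDensity_iff_integrable_smul' (measurable_jacobiDensity α β)
    (by simp)]
  have := intervalIntegrable_jacobiWeight_mul hα hβ f
  rw [intervalIntegrable_iff_integrableOn_Icc_of_le (by norm_num)] at this
  refine this.congr_fun (fun x hx => ?_) measurableSet_Icc
  simp only [jacobiDensity_toReal hx, smul_eq_mul]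

/-- Integration against the Jacobi measure, as a linear functional on polynomials. -/
def jacobiFunctional {α β : ℝ} (hα : -1 < α) (hβ : -1 < β) : ℝ[X] →ₗ[ℝ] ℝ where
  toFun f := ∫ x, f.eval x ∂(jacobiMeasure α β)
  map_add' f g := by
    simp only [eval_add]
    exact integral_add (integrable_jacobiMeasure_eval hα hβ f)
      (integrable_jacobiMeasure_eval hα hβ g)
  map_smul' r f := by
    simp only [eval_smul, smul_eq_mul, RingHom.id_apply]
    exact integral_const_mul _ _

theorem jacobiFunctional_apply {α β : ℝ} (hα : -1 < α) (hβ : -1 < β) (f : ℝ[X]) :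
    jacobiFunctional hα hβ f = ∫ x, f.eval x ∂(jacobiMeasure α β) := rfl

theorem jacobiFunctional_mul_self_pos {α β : ℝ} (hα : -1 < α) (hβ : -1 < β) {f : ℝ[X]}
    (hf : f ≠ 0) : 0 < jacobiFunctional hα hβ (f * f) := by
  rw [jacobiFunctional_apply, integral_jacobiMeasure,
    intervalIntegral.integral_of_le (by norm_num), integral_Ioc_eq_integral_Ioo]
  have hw : ∀ x ∈ Set.Ioo (-1 : ℝ) 1, 0 < (1 - x) ^ α * (1 + x) ^ β := fun x hx =>
    mul_pos (Real.rpow_pos_of_pos (by linarith [hx.2]) _)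
      (Real.rpow_pos_of_pos (by linarith [hx.1]) _)
  rw [setIntegral_pos_iff_support_of_nonneg_ae]
  · have hsub : Set.Ioo (-1 : ℝ) 1 \ (f.roots.toFinset : Set ℝ) ⊆
        (Function.support fun x : ℝ => (1 - x) ^ α * (1 + x) ^ β * (f * f).eval x) ∩
          Set.Ioo (-1) 1 := by
      rintro x ⟨hx, hr⟩
      refine ⟨?_, hx⟩
      have hfx : f.eval x ≠ 0 := by simpa [hf] using hr
      rw [Function.mem_support, eval_mul]
      exact mul_ne_zero (hw x hx).ne' (mul_ne_zero hfx hfx)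
    refine lt_of_lt_of_le ?_ (measure_mono hsub)
    rw [measure_sdiff_null (Finset.measure_zero _ _), Real.volume_Ioo]
    norm_num
  · filter_upwards [ae_restrict_mem measurableSet_Ioo] with x hx
    rw [eval_mul]
    exact mul_nonneg (hw x hx).le (mul_self_nonneg _)
  · exact (intervalIntegrable_iff_integrableOn_Ioo_of_le (by norm_num)).1
      (intervalIntegrable_jacobiWeight_mul hα hβ (f * f))

/-- The Pearson equation of the Jacobi weight, in weak form. -/
theorem jacobiFunctional_pearson {α β : ℝ} (hα : -1 < α) (hβ : -1 < β) (f : ℝ[X]) :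
    jacobiFunctional hα hβ ((1 - X ^ 2) * derivative f +
      (C (β - α) - C (α + β + 2) * X) * f) = 0 := by
  rw [jacobiFunctional_apply, integral_jacobiMeasure]
  have key := intervalIntegral.integral_eq_sub_of_hasDerivAt_of_le (a := -1) (b := 1) (by norm_num)
    (f := fun x : ℝ => (1 - x) ^ (α + 1) * (1 + x) ^ (β + 1) * f.eval x)
    (f' := fun x : ℝ => (1 - x) ^ α * (1 + x) ^ β * ((1 - X ^ 2) * derivative f +
      (C (β - α) - C (α + β + 2) * X) * f).eval x) ?_ ?_
    (intervalIntegrable_jacobiWeight_mul hα hβ _)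
  · rw [key]
    simp [Real.zero_rpow (by linarith : α + 1 ≠ 0), Real.zero_rpow (by linarith : β + 1 ≠ 0)]
  · refine ((ContinuousOn.rpow_const (by fun_prop) fun x _ => Or.inr (by linarith)).mul
      (ContinuousOn.rpow_const (by fun_prop) fun x _ => Or.inr (by linarith))).mul
      f.continuous.continuousOn
  · intro x hx
    have h1 : 0 < 1 - x := by linarith [hx.2]
    have h2 : 0 < 1 + x := by linarith [hx.1]
    have d1 := ((hasDerivAt_id x).const_sub 1).rpow_const (p := α + 1) (Or.inl h1.ne')
    have d2 := ((hasDerivAt_id x).const_add 1).rpow_const (p := β + 1) (Or.inl h2.ne')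
    refine ((d1.mul d2).mul (f.hasDerivAt x)).congr_deriv ?_
    simp only [id, add_sub_cancel_right, Real.rpow_add_one h1.ne', Real.rpow_add_one h2.ne',
      eval_add, eval_mul, eval_sub, eval_one, eval_pow, eval_X, eval_C, Pi.mul_apply]
    ring

theorem mem_submodule_of_degree_lt {B : ℕ → ℝ[X]} (hm : ∀ m, (B m).Monic)
    (hd : ∀ m, (B m).natDegree = m) (M : Submodule ℝ ℝ[X]) {n : ℕ} (hM : ∀ m < n, B m ∈ M)
    {f : ℝ[X]} (hf : f.degree < n) : f ∈ M := by
  induction n generalizing f with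
  | zero =>
    have : f = 0 := by simpa [degree_lt_iff_coeff_zero, Polynomial.ext_iff] using hf
    simp [this]
  | succ n ih =>
    have hBn : (B n).coeff n = 1 := by simpa [hd n] using (hm n).coeff_natDegree
    have hlow : f - f.coeff n • B n ∈ M := by
      refine ih (fun m hmn => hM m (by omega)) ((degree_lt_iff_coeff_zero _ _).2 fun m hnm => ?_)
      rcases hnm.eq_or_lt with rfl | hlt
      · simp [hBn]
      · rw [coeff_sub, coeff_smul, (degree_lt_iff_coeff_zero _ _).1 hf m hlt,
          coeff_eq_zero_of_natDegree_lt (p := B n) (by rwa [hd])]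
        simp
    simpa using M.add_mem hlow (M.smul_mem (f.coeff n) (hM n (by omega)))

/-- `P` is the sequence of monic orthogonal polynomials of the positive definite functional `L`. -/
structure IsMonicOrthogonal (L : ℝ[X] →ₗ[ℝ] ℝ) (P : ℕ → ℝ[X]) : Prop where
  monic : ∀ m, (P m).Monic
  natDegree : ∀ m, (P m).natDegree = m
  pos : ∀ f, f ≠ 0 → 0 < L (f * f)
  orth : ∀ m l, m ≠ l → L (P m * P l) = 0

namespace IsMonicOrthogonal

variable {L : ℝ[X] →ₗ[ℝ] ℝ} {P : ℕ → ℝ[X]}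

theorem coeff_self (hP : IsMonicOrthogonal L P) (n : ℕ) : (P n).coeff n = 1 := by
  simpa [hP.natDegree n] using (hP.monic n).coeff_natDegree

theorem coeff_of_lt (hP : IsMonicOrthogonal L P) {n m : ℕ} (h : n < m) : (P n).coeff m = 0 :=
  coeff_eq_zero_of_natDegree_lt (by rwa [hP.natDegree])

theorem norm_pos (hP : IsMonicOrthogonal L P) (n : ℕ) : 0 < L (P n * P n) :=
  hP.pos _ (hP.monic n).ne_zero

theorem apply_mul_eq_zero (hP : IsMonicOrthogonal L P) {n : ℕ} {f : ℝ[X]} (hf : f.degree < n) :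
    L (P n * f) = 0 :=
  mem_submodule_of_degree_lt hP.monic hP.natDegree
    (LinearMap.ker (L ∘ₗ LinearMap.mulLeft ℝ (P n))) (fun m hm => hP.orth n m hm.ne') hf

theorem apply_mul (hP : IsMonicOrthogonal L P) {n : ℕ} {f : ℝ[X]}
    (hf : ∀ m, n < m → f.coeff m = 0) : L (P n * f) = f.coeff n * L (P n * P n) := by
  have hlow : (f - f.coeff n • P n).degree < n := by
    refine (degree_lt_iff_coeff_zero _ _).2 fun m hnm => ?_
    rcases hnm.eq_or_lt with rfl | hlt
    · simp [hP.coeff_self]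
    · simp [hf m hlt, hP.coeff_of_lt hlt]
  have := hP.apply_mul_eq_zero hlow
  rwa [mul_sub, mul_smul_comm, map_sub, map_smul, smul_eq_mul, sub_eq_zero] at this

theorem eq_zero (hP : IsMonicOrthogonal L P) {n : ℕ} {f : ℝ[X]} (hf : f.degree < n)
    (h : ∀ m < n, L (f * P m) = 0) : f = 0 := by
  by_contra hne
  have : L (f * f) = 0 := mem_submodule_of_degree_lt hP.monic hP.natDegree
    (LinearMap.ker (L ∘ₗ LinearMap.mulLeft ℝ f)) h hf
  exact (hP.pos f hne).ne' this

theorem apply_X_mul_sq (hP : IsMonicOrthogonal L P) {n : ℕ} (hn : 1 ≤ n) {a b : ℝ}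
    (hrec : X * P n = P (n + 1) + C a * P n + C b * P (n - 1)) :
    L (P n * (X * P n)) = a * L (P n * P n) := by
  rw [hrec, mul_add, mul_add, map_add, map_add, hP.orth _ _ (by omega), mul_left_comm,
    mul_left_comm (P n), ← smul_eq_C_mul, ← smul_eq_C_mul, map_smul, map_smul,
    hP.orth n (n - 1) (by omega)]
  simp

theorem norm_eq (hP : IsMonicOrthogonal L P) {n : ℕ} (hn : 1 ≤ n) {a b : ℝ}
    (hrec : X * P n = P (n + 1) + C a * P n + C b * P (n - 1)) :
    L (P n * P n) = b * L (P (n - 1) * P (n - 1)) := by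
  have h1 : L (P (n - 1) * (X * P n)) = b * L (P (n - 1) * P (n - 1)) := by
    rw [hrec, mul_add, mul_add, map_add, map_add, hP.orth _ _ (by omega), mul_left_comm,
      mul_left_comm (P (n - 1)), ← smul_eq_C_mul, ← smul_eq_C_mul, map_smul, map_smul,
      hP.orth (n - 1) n (by omega)]
    simp
  have h2 := hP.apply_mul (n := n) (f := X * P (n - 1)) fun m hm => by
    obtain ⟨k, rfl⟩ : ∃ k, m = k + 1 := ⟨m - 1, by omega⟩
    rw [coeff_X_mul, hP.coeff_of_lt (by omega)]
  obtain ⟨k, rfl⟩ : ∃ k, n = k + 1 := ⟨n - 1, by omega⟩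
  rw [coeff_X_mul, Nat.add_sub_cancel, hP.coeff_self, one_mul] at h2
  rw [← h2, ← h1, Nat.add_sub_cancel]
  congr 1
  ring

theorem zero_eq_one (hP : IsMonicOrthogonal L P) : P 0 = 1 :=
  (hP.monic 0).natDegree_eq_zero.1 (hP.natDegree 0)

/-- The Christoffel–Darboux formula, as an identity of polynomials in the second variable. -/
theorem christoffel_darboux (hP : IsMonicOrthogonal L P) {a b : ℕ → ℝ}
    (hrec : ∀ m, 1 ≤ m → X * P m = P (m + 1) + C (a m) * P m + C (b m) * P (m - 1))
    {n : ℕ} (hn : 1 ≤ n) (x : ℝ) :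
    (C x - X) * ∑ m ∈ Finset.range n, C ((P m).eval x / L (P m * P m)) * P m =
      C ((P n).eval x / L (P (n - 1) * P (n - 1))) * P (n - 1) -
        C ((P (n - 1)).eval x / L (P (n - 1) * P (n - 1))) * P n := by
  refine Polynomial.funext fun y => ?_
  simp only [eval_mul, eval_sub, eval_C, eval_X, eval_finsetSum]
  induction n, hn using Nat.le_induction with
  | base =>
    have h0 := hP.zero_eq_one
    obtain ⟨r, hr⟩ : ∃ r, P 1 = X + C r :=
      ⟨_, (hP.monic 1).eq_X_add_C (hP.natDegree 1)⟩
    simp [h0, hr]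
    ring
  | succ n hn ih =>
    have hx := congrArg (eval x) (hrec n hn)
    have hy := congrArg (eval y) (hrec n hn)
    simp only [eval_mul, eval_add, eval_C, eval_X] at hx hy
    have hnorm := hP.norm_eq hn (hrec n hn)
    have h1 := (hP.norm_pos (n - 1)).ne'
    have h2 := (hP.norm_pos n).ne'
    rw [Finset.sum_range_succ, mul_add, ih, Nat.add_sub_cancel]
    rw [hnorm] at h2 ⊢
    have hb := left_ne_zero_of_mul h2
    field_simp
    linear_combination (P n).eval y * hx - (P n).eval x * hy

end IsMonicOrthogonal

theorem coeff_one_sub_X_sq_mul_derivative (f : ℝ[X]) (n : ℕ) :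
    ((1 - X ^ 2) * derivative f).coeff (n + 1) = (n + 2) * f.coeff (n + 2) - n * f.coeff n := by
  rw [sub_mul, one_mul, coeff_sub, coeff_derivative, coeff_X_pow_mul']
  rcases n with _ | n
  · simp [mul_comm]; norm_num
  · rw [if_pos (by omega), coeff_derivative]
    simp only [Nat.reduceSubDiff]
    push_cast
    ring

section Pearson

variable {L : ℝ[X] →ₗ[ℝ] ℝ} {s t : ℝ}

theorem pearson_by_parts (hL : ∀ f, L ((1 - X ^ 2) * derivative f + (C t - C s * X) * f) = 0)
    (f g : ℝ[X]) : L ((1 - X ^ 2) * derivative f * g) =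
      -L (f * ((1 - X ^ 2) * derivative g + (C t - C s * X) * g)) := by
  rw [eq_neg_iff_add_eq_zero, ← map_add, ← hL (f * g), derivative_mul]
  congr 1
  ring

/-- The structure relation of a classical family, in terms of its recurrence coefficients. -/
theorem IsMonicOrthogonal.structure_relation {P : ℕ → ℝ[X]} (hP : IsMonicOrthogonal L P)
    (hL : ∀ f, L ((1 - X ^ 2) * derivative f + (C t - C s * X) * f) = 0) {n : ℕ} (hn : 1 ≤ n)
    {a b : ℝ} (hrec : X * P n = P (n + 1) + C a * P n + C b * P (n - 1)) :
    (1 - X ^ 2) * derivative (P n) =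
      (C (n * a + (s * a - t) / 2) - C (n : ℝ) * X) * P n +
        C ((2 * n - 1 + s) * b) * P (n - 1) := by
  set u := n * a + (s * a - t) / 2 with hu
  have hnorm := hP.norm_eq hn hrec
  rw [← sub_eq_zero]
  refine hP.eq_zero (n := n + 1) ((degree_lt_iff_coeff_zero _ _).2 fun m hm => ?_) fun m hm => ?_
  · obtain ⟨k, rfl⟩ : ∃ k, m = k + 1 := ⟨m - 1, by omega⟩
    rw [coeff_sub, coeff_one_sub_X_sq_mul_derivative, coeff_add, sub_mul, coeff_sub, mul_assoc,
      coeff_C_mul, coeff_C_mul, coeff_C_mul, coeff_X_mul, hP.coeff_of_lt (m := k + 1) (by omega),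
      hP.coeff_of_lt (m := k + 2) (by omega), hP.coeff_of_lt (n := n - 1) (by omega)]
    rcases (by omega : n = k ∨ n < k) with rfl | hlt
    · simp
    · simp [hP.coeff_of_lt hlt]
  · have split : L (((1 - X ^ 2) * derivative (P n) - ((C u - C (n : ℝ) * X) * P n +
        C ((2 * n - 1 + s) * b) * P (n - 1))) * P m) =
        L ((1 - X ^ 2) * derivative (P n) * P m) - u * L (P n * P m) + n * L (P n * (X * P m)) -
          (2 * n - 1 + s) * b * L (P (n - 1) * P m) := by
      simp only [← smul_eq_mul (a := (_ : ℝ)), ← map_smul, ← map_sub, ← map_add]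
      congr 1
      simp only [smul_eq_C_mul]
      ring
    rw [split]
    rcases (by omega : m = n ∨ m < n) with rfl | hlt
    · have h1 := pearson_by_parts hL (P m) (P m)
      have h2 : L (P m * ((1 - X ^ 2) * derivative (P m) + (C t - C s * X) * P m)) =
          L ((1 - X ^ 2) * derivative (P m) * P m) + t * L (P m * P m) -
            s * L (P m * (X * P m)) := by
        simp only [← smul_eq_mul (a := (_ : ℝ)), ← map_smul, ← map_sub, ← map_add]
        congr 1
        simp only [smul_eq_C_mul]
        ring
      have h3 := hP.apply_X_mul_sq hn hrec
      rw [h3, hP.orth (m - 1) m (by omega)]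
      rw [h2, h3] at h1
      rw [hu]
      linear_combination h1 / 2
    · have hG : ∀ l, n ≤ l → ((1 - X ^ 2) * derivative (P m) + (C t - C s * X) * P m -
          C (n : ℝ) * (X * P m)).coeff l = if n = m + 1 ∧ l = n then -(2 * n - 1 + s) else 0 := by
        intro l hl
        obtain ⟨k, rfl⟩ : ∃ k, l = k + 1 := ⟨l - 1, by omega⟩
        rw [coeff_sub, coeff_add, coeff_one_sub_X_sq_mul_derivative, sub_mul, coeff_sub, mul_assoc,
          coeff_C_mul, coeff_C_mul, coeff_C_mul, coeff_X_mul,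
          hP.coeff_of_lt (m := k + 1) (by omega), hP.coeff_of_lt (m := k + 2) (by omega)]
        split_ifs with hif
        · obtain rfl : k = m := by omega
          rw [hP.coeff_self, hif.1]
          push_cast
          ring
        · simp [hP.coeff_of_lt (by omega : m < k)]
      have h1 := hP.apply_mul fun l hl => by rw [hG l hl.le, if_neg (by omega)]
      rw [hG n le_rfl] at h1
      have h2 := pearson_by_parts hL (P n) (P m)
      rw [mul_sub, map_sub, mul_left_comm (P n) (C (n : ℝ)), ← smul_eq_C_mul (n : ℝ), map_smul,
        smul_eq_mul] at h1
      rw [hP.orth n m (by omega), h2]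
      split_ifs at h1 with hif
      · obtain rfl : m = n - 1 := by omega
        linear_combination -h1 + (2 * n - 1 + s) * hnorm
      · rw [hP.orth (n - 1) m (by omega)]
        linear_combination -h1

theorem IsMonicOrthogonal.one_eq {P : ℕ → ℝ[X]} (hP : IsMonicOrthogonal L P)
    (hL : ∀ f, L ((1 - X ^ 2) * derivative f + (C t - C s * X) * f) = 0) :
    C s * P 1 = C s * X - C t := by
  obtain ⟨r, hr⟩ : ∃ r, P 1 = X + C r := ⟨_, (hP.monic 1).eq_X_add_C (hP.natDegree 1)⟩
  have h0 := hP.norm_pos 0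
  have h1 := hP.orth 1 0 (by norm_num)
  have h2 := hL 1
  rw [hP.zero_eq_one, mul_one] at h0 h1
  have h3 : L (X + C r) = L X + r * L 1 := by
    rw [← mul_one (C r), ← smul_eq_C_mul, map_add, map_smul, smul_eq_mul]
  have h4 : L ((1 - X ^ 2) * derivative 1 + (C t - C s * X) * 1) = t * L 1 - s * L X := by
    simp only [← smul_eq_mul (a := (_ : ℝ)), ← map_smul, ← map_sub]
    congr 1
    simp only [smul_eq_C_mul, derivative_one]
    ring
  rw [hr, h3] at h1
  rw [h4] at h2
  have h5 : (s * r + t) * L 1 = 0 := by linear_combination h2 + s * h1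
  have h6 : t = -(s * r) := by linarith [(mul_eq_zero.1 h5).resolve_right h0.ne']
  rw [hr, h6]
  simp
  ring

end Pearson

theorem bhat_eq {α β : ℝ} {n : ℕ} (hs : 2 * (n : ℝ) + α + β + 1 ≠ 0) :
    bhat α β n = (2 * n - 1 + (α + β + 2)) * gamma2 α β n := by
  have h1 : (2 * n - 1 + (α + β + 2) : ℝ) = 2 * n + α + β + 1 := by ring
  have h2 : ((2 * n + α + β) ^ 2 - 1 : ℝ) = (2 * n + α + β - 1) * (2 * n + α + β + 1) := by ring
  rw [bhat, gamma2, h1, h2, ← mul_assoc (_ ^ 2), mul_div_assoc', mul_comm (2 * n + α + β + 1 : ℝ),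
    mul_div_mul_right _ _ hs]

theorem ahat_eq {α β : ℝ} {n : ℕ} (h1 : 2 * (n : ℝ) + α + β ≠ 0)
    (h2 : 2 * (n : ℝ) + α + β + 2 ≠ 0) :
    ahat α β n = C (n * gamma1 α β n + ((α + β + 2) * gamma1 α β n - (β - α)) / 2) -
      C (n : ℝ) * X := by
  have e1 : C (-(n : ℝ) / (2 * n + α + β)) * C (2 * (n : ℝ) + α + β) = -C (n : ℝ) := by
    rw [← C_mul, div_mul_cancel₀ _ h1, C_neg]
  have e2 : C (-(n : ℝ) / (2 * n + α + β)) * C (β - α) =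
      C (n * gamma1 α β n + ((α + β + 2) * gamma1 α β n - (β - α)) / 2) := by
    rw [← C_mul, gamma1]
    congr 1
    obtain ⟨D, hD⟩ : ∃ D, 2 * (n : ℝ) + α + β = D := ⟨_, rfl⟩
    obtain rfl : α = D - 2 * n - β := by linarith
    rw [hD] at h1 h2 ⊢
    field_simp
    ring
  rw [ahat, mul_add, ← mul_assoc, e1, e2]
  ring

section Jacobi

variable {L : ℝ[X] →ₗ[ℝ] ℝ} {P : ℕ → ℝ[X]} {α β : ℝ}

theorem IsMonicOrthogonal.jacobi_structure (hP : IsMonicOrthogonal L P) (hα : -1 < α)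
    (hβ : -1 < β) (hL : ∀ f, L ((1 - X ^ 2) * derivative f +
      (C (β - α) - C (α + β + 2) * X) * f) = 0)
    (hrec : ∀ m, 1 ≤ m → X * P m =
      P (m + 1) + C (gamma1 α β m) * P m + C (gamma2 α β m) * P (m - 1))
    {n : ℕ} (hn : 1 ≤ n) :
    (1 - X ^ 2) * derivative (P n) = ahat α β n * P n + C (bhat α β n) * P (n - 1) := by
  have hn' : (1 : ℝ) ≤ n := by exact_mod_cast hn
  rw [hP.structure_relation hL hn (hrec n hn), ahat_eq (by linarith) (by linarith),
    bhat_eq (by linarith)]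

theorem IsMonicOrthogonal.jacobi_structure_pred (hP : IsMonicOrthogonal L P) (hα : -1 < α)
    (hβ : -1 < β) (hL : ∀ f, L ((1 - X ^ 2) * derivative f +
      (C (β - α) - C (α + β + 2) * X) * f) = 0)
    (hrec : ∀ m, 1 ≤ m → X * P m =
      P (m + 1) + C (gamma1 α β m) * P m + C (gamma2 α β m) * P (m - 1))
    {n : ℕ} (hn : 1 ≤ n) :
    (1 - X ^ 2) * derivative (P (n - 1)) =
      chat α β n * P (n - 1) + C (dhat α β n) * P n := by
  obtain rfl | ⟨k, rfl, hk⟩ : n = 1 ∨ ∃ k, n = k + 1 ∧ 1 ≤ k :=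
    (by omega : n = 1 ∨ 2 ≤ n).imp id fun h => ⟨n - 1, by omega, by omega⟩
  · have h1 := hP.one_eq hL
    have hs : α + β + 2 ≠ 0 := by linarith
    have h2 : P 1 = X - C ((β - α) / (α + β + 2)) := by
      have : C (α + β + 2) * P 1 = C (α + β + 2) * (X - C ((β - α) / (α + β + 2))) := by
        rw [h1, mul_sub, ← C_mul]; congr 2; field_simp
      exact mul_left_cancel₀ (C_ne_zero.2 hs) this
    rw [Nat.sub_self, hP.zero_eq_one, h2, chat, dhat]
    refine Polynomial.funext fun x => ?_
    have hs' : 2 + α + β ≠ 0 := by linarith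
    simp
    field_simp
    ring
  · have hk' : (1 : ℝ) ≤ k := by exact_mod_cast hk
    have h1 := hP.jacobi_structure hα hβ hL hrec hk
    have h2 := hrec k hk
    rw [bhat_eq (by linarith), ahat_eq (by linarith) (by linarith)] at h1
    rw [Nat.add_sub_cancel, h1, chat, dhat]
    refine Polynomial.funext fun x => ?_
    have h3 := congrArg (eval x) h2
    have d1 : 2 * (k : ℝ) + α + β ≠ 0 := by linarith
    have d2 : 2 * (k : ℝ) + α + β + 2 ≠ 0 := by linarith
    have d3 : 2 * ((k : ℝ) + 1) + α + β ≠ 0 := by linarith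
    simp only [eval_mul, eval_add, eval_C, eval_X, eval_sub] at h3 ⊢
    push_cast
    have e : ((k : ℝ) * gamma1 α β k + ((α + β + 2) * gamma1 α β k - (β - α)) / 2) -
        (2 * k + 1 + α + β) * gamma1 α β k = (k + 1 + α + β) / (2 * (k + 1) + α + β) * (α - β) := by
      rw [gamma1]
      obtain ⟨D, hD⟩ : ∃ D, 2 * (k : ℝ) + α + β = D := ⟨_, rfl⟩
      obtain rfl : α = D - 2 * k - β := by linarith
      rw [hD] at d1 d2 ⊢
      have hD' : 2 * ((k : ℝ) + 1) + (D - 2 * k - β) + β = D + 2 := by ring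
      rw [hD']
      field_simp
      ring
    have e' : ((k : ℝ) + 1 + α + β) / (2 * (k + 1) + α + β) * (2 * (k + 1) + α + β) =
        k + 1 + α + β := div_mul_cancel₀ _ d3
    linear_combination (P k).eval x * e - (P k).eval x * x * e' - (2 * k + 1 + α + β) * h3

end Jacobi

/-- The functional `f ↦ f⁽ᵏ⁾(c)`. -/
def evalDeriv (k : ℕ) (c : ℝ) : ℝ[X] →ₗ[ℝ] ℝ := leval c ∘ₗ (derivative ^ k)

theorem evalDeriv_apply (k : ℕ) (c : ℝ) (f : ℝ[X]) :
    evalDeriv k c f = (iterDeriv k f).eval c := by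
  simp [evalDeriv, iterDeriv, Module.End.pow_apply]

theorem iterDeriv_succ_sub_X_mul (x : ℝ) (f : ℝ[X]) (k : ℕ) :
    iterDeriv (k + 1) ((C x - X) * f) =
      (C x - X) * iterDeriv (k + 1) f - (k + 1 : ℝ[X]) * iterDeriv k f := by
  induction k with
  | zero => simp [iterDeriv]; ring
  | succ k ih =>
    simp only [iterDeriv, Function.iterate_succ_apply'] at ih ⊢
    rw [ih]
    simp
    ring

theorem eval_taylorPoly (k : ℕ) (c x : ℝ) (f : ℝ[X]) :
    (taylorPoly k c f).eval x =
      ∑ ν ∈ Finset.range (k + 1), evalDeriv ν c f / Nat.factorial ν * (x - c) ^ ν := by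
  simp [taylorPoly, eval_finsetSum, evalDeriv_apply]

theorem eval_taylorPoly_sub_X_mul (k : ℕ) (c x : ℝ) (f : ℝ[X]) :
    k.factorial * (taylorPoly k c ((C x - X) * f)).eval x =
      (x - c) ^ (k + 1) * evalDeriv k c f := by
  induction k with
  | zero => simp [eval_taylorPoly, evalDeriv_apply, iterDeriv]
  | succ k ih =>
    have hk : (k.factorial : ℝ) ≠ 0 := by exact_mod_cast k.factorial_ne_zero
    have hk' : (k + 1 : ℝ) ≠ 0 := by positivity
    rw [eval_taylorPoly] at ih ⊢
    rw [Finset.sum_range_succ, mul_add, Nat.factorial_succ]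
    push_cast
    rw [mul_assoc, ih, evalDeriv_apply (k + 1), iterDeriv_succ_sub_X_mul]
    simp only [eval_sub, eval_mul, eval_C, eval_X, eval_add, eval_natCast, eval_one,
      evalDeriv_apply]
    field_simp
    ring

theorem natDegree_taylorPoly_le (k : ℕ) (c : ℝ) (f : ℝ[X]) :
    (taylorPoly k c f).natDegree ≤ k := by
  refine natDegree_sum_le_of_forall_le _ _ fun ν hν => ?_
  refine (natDegree_C_mul_le _ _).trans ?_
  rw [natDegree_pow, natDegree_X_sub_C, mul_one]
  exact Nat.lt_succ_iff.1 (Finset.mem_range.1 hν)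

theorem coeff_taylorPoly (k : ℕ) (c : ℝ) (f : ℝ[X]) :
    (taylorPoly k c f).coeff k = evalDeriv k c f / k.factorial := by
  have htop : ((X - C c) ^ k : ℝ[X]).coeff k = 1 := by
    simpa using ((monic_X_sub_C c).pow k).coeff_natDegree
  rw [taylorPoly, finsetSum_coeff, Finset.sum_range_succ, Finset.sum_eq_zero, coeff_C_mul, htop,
    evalDeriv_apply]
  · ring
  · intro ν hν
    rw [coeff_C_mul, coeff_eq_zero_of_natDegree_lt, mul_zero]
    rw [natDegree_pow, natDegree_X_sub_C, mul_one]
    exact Finset.mem_range.1 hν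

theorem degree_sub_lt_of_monic {f g : ℝ[X]} {n : ℕ} (hf : f.Monic) (hg : g.Monic)
    (hfn : f.natDegree = n) (hgn : g.natDegree = n) : (f - g).degree < n := by
  have hfd := hfn ▸ degree_eq_natDegree hf.ne_zero
  have hgd := hgn ▸ degree_eq_natDegree hg.ne_zero
  have := degree_sub_lt_left (hfd.trans hgd.symm) hf.ne_zero
    (hf.leadingCoeff.trans hg.leadingCoeff.symm)
  rwa [hfd] at this

section Connection

variable {N : ℕ} (c : Fin N → ℝ) (dd : Fin N → ℕ) (lam : Fin N → ℕ → ℝ)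

theorem rhoPoly_monic : (rhoPoly c dd).Monic :=
  monic_prod_of_monic _ _ fun j _ => (monic_X_sub_C (c j)).pow _

theorem rhoPoly_natDegree : (rhoPoly c dd).natDegree = ∑ j, (dd j + 1) := by
  rw [rhoPoly, natDegree_prod_of_monic _ _ fun j _ => (monic_X_sub_C (c j)).pow _]
  simp only [natDegree_pow, natDegree_X_sub_C, mul_one]

theorem rhoJK_monic (j : Fin N) (k : ℕ) : (rhoJK c dd j k).Monic :=
  ((monic_X_sub_C _).pow _).mul
    (monic_prod_of_monic _ _ fun j _ => (monic_X_sub_C (c j)).pow _)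

variable {dd} in
theorem pow_mul_rhoJK {j : Fin N} {k : ℕ} (hk : k ≤ dd j) :
    (X - C (c j)) ^ (k + 1) * rhoJK c dd j k = rhoPoly c dd := by
  rw [rhoJK, rhoPoly, ← mul_assoc, ← pow_add, show k + 1 + (dd j - k) = dd j + 1 by omega,
    Finset.mul_prod_erase Finset.univ (fun i => (X - C (c i)) ^ (dd i + 1)) (Finset.mem_univ j)]

variable {dd} in
theorem rhoJK_natDegree {j : Fin N} {k : ℕ} (hk : k ≤ dd j) :
    k + 1 + (rhoJK c dd j k).natDegree = ∑ j, (dd j + 1) := by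
  rw [← rhoPoly_natDegree c dd, ← pow_mul_rhoJK c hk,
    ((monic_X_sub_C (c j)).pow _).natDegree_mul (rhoJK_monic c dd j k), natDegree_pow, natDegree_X_sub_C, mul_one]

/-- The combination of Taylor polynomials of `f` occurring in the connection coefficients. -/
def sobolevCorrection (η : ℝ) (S f : ℝ[X]) : ℝ[X] :=
  ∑ j : Fin N, ∑ k ∈ Finset.range (dd j + 1),
    C ((Nat.factorial k : ℝ) * lam j k * (iterDeriv k S).eval (c j) / η) *
      (taylorPoly k (c j) f * rhoJK c dd j k)

/-- The Sobolev-type functional `f ↦ L (f S) + ∑ λ_{j,k} f⁽ᵏ⁾(c_j) S⁽ᵏ⁾(c_j)`. -/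
def sobolevFunctional (L : ℝ[X] →ₗ[ℝ] ℝ) (S : ℝ[X]) : ℝ[X] →ₗ[ℝ] ℝ :=
  L ∘ₗ LinearMap.mulRight ℝ S + ∑ j : Fin N, ∑ k ∈ Finset.range (dd j + 1),
    (lam j k * evalDeriv k (c j) S) • evalDeriv k (c j)

theorem sobolevFunctional_apply (L : ℝ[X] →ₗ[ℝ] ℝ) (S f : ℝ[X]) :
    sobolevFunctional c dd lam L S f = L (f * S) + ∑ j : Fin N, ∑ k ∈ Finset.range (dd j + 1),
      lam j k * evalDeriv k (c j) S * evalDeriv k (c j) f := by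
  simp [sobolevFunctional, LinearMap.sum_apply]

theorem natDegree_sobolevCorrection_le {e : ℕ} (he : ∑ j, (dd j + 1) = e + 1) (η : ℝ)
    (S f : ℝ[X]) : (sobolevCorrection c dd lam η S f).natDegree ≤ e := by
  refine natDegree_sum_le_of_forall_le _ _ fun j _ =>
    natDegree_sum_le_of_forall_le _ _ fun k hk => ?_
  have := rhoJK_natDegree c (Nat.lt_succ_iff.1 (Finset.mem_range.1 hk))
  have := natDegree_taylorPoly_le k (c j) f
  refine (natDegree_C_mul_le _ _).trans (natDegree_mul_le.trans ?_)
  omega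

theorem coeff_sobolevCorrection {e : ℕ} (he : ∑ j, (dd j + 1) = e + 1) (η : ℝ)
    (S f : ℝ[X]) : (sobolevCorrection c dd lam η S f).coeff e =
      (∑ j : Fin N, ∑ k ∈ Finset.range (dd j + 1),
        lam j k * evalDeriv k (c j) S * evalDeriv k (c j) f) / η := by
  rw [sobolevCorrection, finsetSum_coeff, Finset.sum_div]
  refine Finset.sum_congr rfl fun j _ => ?_
  rw [finsetSum_coeff, Finset.sum_div]
  refine Finset.sum_congr rfl fun k hk => ?_
  have h1 := rhoJK_natDegree c (Nat.lt_succ_iff.1 (Finset.mem_range.1 hk))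
  have h2 := (rhoJK_monic c dd j k).coeff_natDegree
  have h3 := coeff_mul_add_eq_of_natDegree_le (natDegree_taylorPoly_le k (c j) f)
    (le_refl (rhoJK c dd j k).natDegree)
  rw [show k + (rhoJK c dd j k).natDegree = e by omega, h2, mul_one, coeff_taylorPoly] at h3
  have hk : (k.factorial : ℝ) ≠ 0 := by exact_mod_cast k.factorial_ne_zero
  rw [coeff_C_mul, h3, ← evalDeriv_apply]
  field_simp

variable {L : ℝ[X] →ₗ[ℝ] ℝ} {P : ℕ → ℝ[X]} {S : ℝ[X]} {n : ℕ}

/-- Expansion of a Sobolev orthogonal polynomial in the kernel polynomials of `L`. -/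
theorem IsMonicOrthogonal.sobolev_expansion (hP : IsMonicOrthogonal L P) (hSm : S.Monic)
    (hSd : S.natDegree = n)
    (hS : ∀ f : ℝ[X], f.degree < n → sobolevFunctional c dd lam L S f = 0) :
    S = P n - ∑ j : Fin N, ∑ k ∈ Finset.range (dd j + 1),
      (lam j k * evalDeriv k (c j) S) •
        ∑ m ∈ Finset.range n, (evalDeriv k (c j) (P m) / L (P m * P m)) • P m := by
  have hlt : ∀ {m}, m < n → (P m).degree < n := fun {m} hm => by
    rw [degree_eq_natDegree (hP.monic m).ne_zero, hP.natDegree]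
    exact_mod_cast hm
  rw [eq_sub_iff_add_eq, ← sub_eq_zero]
  refine hP.eq_zero (n := n) ?_ fun m hm => ?_
  · rw [add_sub_right_comm]
    refine (degree_add_le _ _).trans_lt (max_lt ?_ ?_)
    · exact degree_sub_lt_of_monic hSm (hP.monic n) hSd (hP.natDegree n)
    · rw [← mem_degreeLT]
      exact Submodule.sum_mem _ fun j _ => Submodule.sum_mem _ fun k _ => Submodule.smul_mem _ _ <|
        Submodule.sum_mem _ fun m hm => Submodule.smul_mem _ _ <|
          mem_degreeLT.2 (hlt (Finset.mem_range.1 hm))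
  · have h1 := hS (P m) (hlt hm)
    rw [sobolevFunctional_apply] at h1
    have h2 : ∀ k j, L ((∑ l ∈ Finset.range n, (evalDeriv k (c j) (P l) / L (P l * P l)) • P l) *
        P m) = evalDeriv k (c j) (P m) := by
      intro k j
      rw [Finset.sum_mul, map_sum, Finset.sum_eq_single_of_mem m (Finset.mem_range.2 hm)]
      · rw [smul_mul_assoc, map_smul, smul_eq_mul, div_mul_cancel₀ _ (hP.norm_pos m).ne']
      · intro l _ hlm
        rw [smul_mul_assoc, map_smul, hP.orth l m hlm, smul_zero]
    have h3 : ∀ (w : Fin N → ℕ → ℝ) (T : Fin N → ℕ → ℝ[X]),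
        L ((∑ j : Fin N, ∑ k ∈ Finset.range (dd j + 1), w j k • T j k) * P m) =
          ∑ j : Fin N, ∑ k ∈ Finset.range (dd j + 1), w j k * L (T j k * P m) := by
      intro w T
      simp only [Finset.sum_mul, map_sum, smul_mul_assoc, map_smul, smul_eq_mul]
    rw [sub_mul, add_mul, map_sub, map_add, hP.orth n m hm.ne', h3]
    simp only [h2]
    rw [mul_comm S]
    linear_combination h1

theorem IsMonicOrthogonal.connection_formula (hP : IsMonicOrthogonal L P) {a b : ℕ → ℝ}
    (hrec : ∀ m, 1 ≤ m → X * P m = P (m + 1) + C (a m) * P m + C (b m) * P (m - 1))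
    (hSm : S.Monic) (hSd : S.natDegree = n) (hn : 1 ≤ n)
    (hS : ∀ f : ℝ[X], f.degree < n → sobolevFunctional c dd lam L S f = 0) :
    rhoPoly c dd * S =
      (rhoPoly c dd - sobolevCorrection c dd lam (L (P (n - 1) * P (n - 1))) S (P (n - 1))) * P n +
        sobolevCorrection c dd lam (L (P (n - 1) * P (n - 1))) S (P n) * P (n - 1) := by
  set η := L (P (n - 1) * P (n - 1))
  refine Polynomial.funext fun x => ?_
  conv_lhs => rw [hP.sobolev_expansion c dd lam hSm hSd hS]
  have kernel : ∀ (j : Fin N), ∀ k ∈ Finset.range (dd j + 1),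
      (rhoPoly c dd).eval x * ∑ m ∈ Finset.range n,
        evalDeriv k (c j) (P m) / L (P m * P m) * (P m).eval x =
      k.factorial * (rhoJK c dd j k).eval x / η * ((P n).eval x *
        (taylorPoly k (c j) (P (n - 1))).eval x -
          (P (n - 1)).eval x * (taylorPoly k (c j) (P n)).eval x) := by
    intro j k hk
    have h1 := eval_taylorPoly_sub_X_mul k (c j) x
      (∑ m ∈ Finset.range n, C ((P m).eval x / L (P m * P m)) * P m)
    rw [hP.christoffel_darboux hrec hn] at h1
    have h2 : (taylorPoly k (c j) (C ((P n).eval x / η) * P (n - 1) -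
        C ((P (n - 1)).eval x / η) * P n)).eval x = (P n).eval x / η *
        (taylorPoly k (c j) (P (n - 1))).eval x -
          (P (n - 1)).eval x / η * (taylorPoly k (c j) (P n)).eval x := by
      simp only [eval_taylorPoly, ← smul_eq_C_mul, map_sub, map_smul, smul_eq_mul,
        Finset.mul_sum, ← Finset.sum_sub_distrib]
      exact Finset.sum_congr rfl fun _ _ => by ring
    have h3 : evalDeriv k (c j) (∑ m ∈ Finset.range n, C ((P m).eval x / L (P m * P m)) * P m) =
        ∑ m ∈ Finset.range n, evalDeriv k (c j) (P m) / L (P m * P m) * (P m).eval x := by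
      simp only [← smul_eq_C_mul, map_sum, map_smul, smul_eq_mul]
      exact Finset.sum_congr rfl fun _ _ => by ring
    have h4 := congrArg (eval x) (pow_mul_rhoJK c (Nat.lt_succ_iff.1 (Finset.mem_range.1 hk)))
    simp only [eval_mul, eval_pow, eval_sub, eval_X, eval_C] at h4
    rw [h2, h3] at h1
    rw [← h4]
    linear_combination -(rhoJK c dd j k).eval x * h1
  simp only [sobolevCorrection, eval_mul, eval_sub, eval_finsetSum, eval_smul,
    smul_eq_mul, eval_C, mul_sub, sub_mul, Finset.mul_sum, Finset.sum_mul, sub_add,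
    ← Finset.sum_sub_distrib]
  congr 1
  refine Finset.sum_congr rfl fun j _ => Finset.sum_congr rfl fun k hk => ?_
  have := kernel j k hk
  rw [Finset.mul_sum] at this
  rw [← evalDeriv_apply]
  calc _ = lam j k * evalDeriv k (c j) S * ∑ m ∈ Finset.range n,
        (rhoPoly c dd).eval x * (evalDeriv k (c j) (P m) / L (P m * P m) * (P m).eval x) := by
        rw [Finset.mul_sum]; exact Finset.sum_congr rfl fun _ _ => by ring
    _ = _ := by rw [this]; ring

theorem IsMonicOrthogonal.norm_add_coeff_pos (hP : IsMonicOrthogonal L P)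
    (hlam : ∀ j k, 0 ≤ lam j k) {e : ℕ} (he : ∑ j, (dd j + 1) = e + 1)
    (hSm : S.Monic) (hSd : S.natDegree = n)
    (hS : ∀ f : ℝ[X], f.degree < n → sobolevFunctional c dd lam L S f = 0) {η : ℝ} (hη : 0 < η) :
    0 < L (P n * P n) / η + (sobolevCorrection c dd lam η S (P n)).coeff e := by
  have hlow : (P n - S).degree < n :=
    degree_sub_lt_of_monic (hP.monic n) hSm (hP.natDegree n) hSd
  have h1 : sobolevFunctional c dd lam L S (P n) = sobolevFunctional c dd lam L S S := by
    rw [← sub_eq_zero, ← map_sub, hS _ hlow]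
  have h2 : L (P n * S) = L (P n * P n) := by
    have := hP.apply_mul_eq_zero hlow
    rw [mul_sub, map_sub] at this
    linarith
  have h3 : 0 < sobolevFunctional c dd lam L S S := by
    rw [sobolevFunctional_apply]
    refine add_pos_of_pos_of_nonneg (hP.pos _ hSm.ne_zero)
      (Finset.sum_nonneg fun j _ => Finset.sum_nonneg fun k _ => ?_)
    rw [mul_assoc]
    exact mul_nonneg (hlam j k) (mul_self_nonneg _)
  rw [coeff_sobolevCorrection c dd lam he, ← add_div]
  rw [sobolevFunctional_apply, h2] at h1
  rw [h1]
  exact div_pos h3 hη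

end Connection

section DegreeBounds

theorem natDegree_mul_le_of_add_le {f g : ℝ[X]} {a b m : ℕ} (hf : f.natDegree ≤ a)
    (hg : g.natDegree ≤ b) (h : a + b ≤ m) : (f * g).natDegree ≤ m :=
  (natDegree_mul_le_of_le hf hg).trans h

theorem natDegree_sub_le_of_both_le {f g : ℝ[X]} {m : ℕ} (hf : f.natDegree ≤ m)
    (hg : g.natDegree ≤ m) : (f - g).natDegree ≤ m :=
  (natDegree_sub_le_of_le hf hg).trans (max_self m).le

theorem natDegree_derivative_le_pred {f : ℝ[X]} {m : ℕ} (hf : f.natDegree ≤ m + 1) :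
    (derivative f).natDegree ≤ m :=
  (natDegree_derivative_le f).trans (by omega)

theorem natDegree_one_sub_X_sq_mul_derivative_le {f : ℝ[X]} {e : ℕ} (hf : f.natDegree ≤ e) :
    ((1 - X ^ 2) * derivative f).natDegree ≤ e + 1 := by
  refine natDegree_le_iff_coeff_eq_zero.2 fun m hm => ?_
  obtain ⟨k, rfl⟩ : ∃ k, m = k + 1 := ⟨m - 1, by omega⟩
  rw [coeff_one_sub_X_sq_mul_derivative, coeff_eq_zero_of_natDegree_lt (n := k) (by omega),
    coeff_eq_zero_of_natDegree_lt (n := k + 2) (by omega)]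
  simp

theorem coeff_one_sub_X_sq_mul_derivative_top {f : ℝ[X]} {e : ℕ} (hf : f.natDegree ≤ e) :
    ((1 - X ^ 2) * derivative f).coeff (e + 1) = -(e * f.coeff e) := by
  rw [coeff_one_sub_X_sq_mul_derivative, coeff_eq_zero_of_natDegree_lt (n := e + 2) (by omega)]
  simp

variable (α β : ℝ) (n : ℕ)

theorem natDegree_ahat_le : (ahat α β n).natDegree ≤ 1 := by
  rw [ahat]
  compute_degree

theorem natDegree_chat_le : (chat α β n).natDegree ≤ 1 := by
  rw [chat]
  compute_degree

variable {α β n}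

theorem coeff_ahat (h : 2 * (n : ℝ) + α + β ≠ 0) : (ahat α β n).coeff 1 = -n := by
  simp [ahat, coeff_C, div_mul_cancel₀ _ h]

theorem coeff_chat (h : 2 * (n : ℝ) + α + β ≠ 0) : (chat α β n).coeff 1 = n + α + β := by
  simp [chat, coeff_C, div_mul_cancel₀ _ h]

variable {A B : ℝ[X]} {e : ℕ}

theorem natDegree_derivedA_le (hA : A.natDegree ≤ e + 1) (hB : B.natDegree ≤ e) :
    ((1 - X ^ 2) * derivative A + ahat α β n * A + C (dhat α β n) * B).natDegree ≤ e + 2 :=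
  natDegree_add_le_of_degree_le
    (natDegree_add_le_of_degree_le (natDegree_one_sub_X_sq_mul_derivative_le hA)
      (natDegree_mul_le_of_add_le (natDegree_ahat_le α β n) hA (by omega)))
    ((natDegree_C_mul_le _ _).trans (by omega))

theorem natDegree_derivedB_le (hA : A.natDegree ≤ e + 1) (hB : B.natDegree ≤ e) :
    ((1 - X ^ 2) * derivative B + C (bhat α β n) * A + chat α β n * B).natDegree ≤ e + 1 :=
  natDegree_add_le_of_degree_le
    (natDegree_add_le_of_degree_le (natDegree_one_sub_X_sq_mul_derivative_le hB)
      ((natDegree_C_mul_le _ _).trans hA))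
    (natDegree_mul_le_of_add_le (natDegree_chat_le α β n) hB (by omega))

/-- The leading coefficient of `B₃ A₂ - A₃ B₂`. -/
theorem coeff_derived_det (h : 2 * (n : ℝ) + α + β ≠ 0) (h' : 2 * (n : ℝ) + α + β + 1 ≠ 0)
    (hA : A.natDegree ≤ e + 1) (hA1 : A.coeff (e + 1) = 1) (hB : B.natDegree ≤ e) :
    (((1 - X ^ 2) * derivative B + C (bhat α β n) * A + chat α β n * B) * A -
      ((1 - X ^ 2) * derivative A + ahat α β n * A + C (dhat α β n) * B) * B).coeff (2 * e + 2) =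
      (2 * n + α + β + 1) * (gamma2 α β n + B.coeff e) := by
  have h1 := coeff_mul_add_eq_of_natDegree_le (natDegree_ahat_le α β n) hA
  have h2 := coeff_mul_add_eq_of_natDegree_le (natDegree_chat_le α β n) hB
  have h3 := coeff_mul_add_eq_of_natDegree_le
    (natDegree_derivedB_le (α := α) (β := β) (n := n) hA hB) hA
  have h4 := coeff_mul_add_eq_of_natDegree_le
    (natDegree_derivedA_le (α := α) (β := β) (n := n) hA hB) hB
  have h5 := coeff_one_sub_X_sq_mul_derivative_top hA
  have h6 := coeff_one_sub_X_sq_mul_derivative_top hB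
  rw [show 1 + (e + 1) = e + 1 + 1 by omega, coeff_ahat h] at h1
  rw [show 1 + e = e + 1 by omega, coeff_chat h] at h2
  rw [coeff_sub, show 2 * e + 2 = e + 1 + (e + 1) by omega, h3,
    show e + 1 + (e + 1) = e + 2 + e by omega, h4]
  simp only [coeff_add, coeff_C_mul, h1, h2, h5, h6, hA1,
    coeff_eq_zero_of_natDegree_lt (show B.natDegree < e + 2 by omega), bhat_eq h']
  push_cast
  ring

end DegreeBounds

section HolonomicEquation

variable {S T p q A B C' D A' B' C'' D' ρ δ w q₀ q₁ q₂ q₃ q₄ : ℝ[X]}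

/-- The ladder equation `q₀ S' + q₂ S = q₁ T` obtained by eliminating `p` and `q`. -/
theorem ladder_equation (hρ : ρ ≠ 0) (hS : ρ * S = A * p + B * q) (hT : ρ * T = C' * p + D * q)
    (hS' : w * derivative (ρ * S) = A' * p + B' * q) (hδ : A * D - B * C' = ρ * δ) :
    w * (A * D - B * C') * derivative S + (w * derivative ρ * δ + B' * C' - A' * D) * S =
      (B' * A - A' * B) * T := by
  rw [derivative_mul] at hS'
  refine mul_left_cancel₀ hρ ?_
  linear_combination (A * D - B * C') * hS' + (B' * C' - A' * D) * hS -
    (B' * A - A' * B) * hT - w * derivative ρ * S * hδ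

theorem holonomic_of_ladder (h₁ : q₀ * derivative S + q₂ * S = q₁ * T)
    (h₂ : q₀ * derivative T + q₃ * T = q₄ * S) :
    q₁ * q₀ ^ 2 * derivative (derivative S) +
      q₀ * (q₁ * q₂ + q₁ * q₃ + derivative q₀ * q₁ - q₀ * derivative q₁) * derivative S +
      (q₁ * q₂ * q₃ + q₀ * (derivative q₂ * q₁ - q₂ * derivative q₁) - q₄ * q₁ ^ 2) * S = 0 := by
  have h₃ := congrArg derivative h₁
  simp only [derivative_add, derivative_mul] at h₃
  linear_combination q₀ * q₁ * h₃ + (q₁ * q₃ - q₀ * derivative q₁) * h₁ + q₁ ^ 2 * h₂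

theorem natDegree_holonomic_coefficients {d : ℕ} (h₀ : q₀.natDegree = 2 * d + 2) (hz₀ : q₀ ≠ 0)
    (h₁ : q₁.natDegree = 2 * d) (hz₁ : q₁ ≠ 0) (h₂ : q₂.natDegree ≤ 2 * d + 1)
    (h₃ : q₃.natDegree ≤ 2 * d + 1) (h₄ : q₄.natDegree ≤ 2 * d) (hd : 1 ≤ d) :
    (q₁ * q₀ ^ 2).natDegree = 6 * d + 4 ∧
    (q₀ * (q₁ * q₂ + q₁ * q₃ + derivative q₀ * q₁ - q₀ * derivative q₁)).natDegree ≤ 6 * d + 3 ∧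
    (q₁ * q₂ * q₃ + q₀ * (derivative q₂ * q₁ - q₂ * derivative q₁) -
      q₄ * q₁ ^ 2).natDegree ≤ 6 * d + 2 := by
  have h₀' : (derivative q₀).natDegree ≤ 2 * d + 1 := natDegree_derivative_le_pred (by omega)
  have h₁' : (derivative q₁).natDegree ≤ 2 * d - 1 := natDegree_derivative_le_pred (by omega)
  have h₂' : (derivative q₂).natDegree ≤ 2 * d := natDegree_derivative_le_pred (by omega)
  refine ⟨?_, ?_, ?_⟩
  · rw [natDegree_mul hz₁ (pow_ne_zero _ hz₀), natDegree_pow, h₀, h₁]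
    ring
  · refine natDegree_mul_le_of_add_le h₀.le (natDegree_sub_le_of_both_le (m := 4 * d + 1)
      (natDegree_add_le_of_degree_le (natDegree_add_le_of_degree_le ?_ ?_) ?_) ?_) (by omega)
    · exact natDegree_mul_le_of_add_le h₁.le h₂ (by omega)
    · exact natDegree_mul_le_of_add_le h₁.le h₃ (by omega)
    · exact natDegree_mul_le_of_add_le h₀' h₁.le (by omega)
    · exact natDegree_mul_le_of_add_le h₀.le h₁' (by omega)
  · refine natDegree_sub_le_of_both_le (natDegree_add_le_of_degree_le ?_ ?_) ?_
    · exact natDegree_mul_le_of_add_le (natDegree_mul_le_of_add_le h₁.le h₂ le_rfl) h₃ (by omega)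
    · refine natDegree_mul_le_of_add_le h₀.le (natDegree_sub_le_of_both_le (m := 4 * d)
        ?_ ?_) (by omega)
      · exact natDegree_mul_le_of_add_le h₂' h₁.le (by omega)
      · exact natDegree_mul_le_of_add_le h₂ h₁' (by omega)
    · rw [sq]
      exact natDegree_mul_le_of_add_le h₄ (natDegree_mul_le_of_add_le h₁.le h₁.le le_rfl)
        (by omega)

/-- The degrees of the polynomials `q₀`, `q₂`, `q₃`, `q₄` in terms of those of the connection
coefficients. -/
theorem natDegree_ladder_coefficients {e : ℕ} (hρm : ρ.Monic) (hρ : ρ.natDegree = e + 1)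
    (hA : A.natDegree ≤ e + 1) (hA1 : A.coeff (e + 1) = 1) (hB : B.natDegree ≤ e)
    (hC : C'.natDegree ≤ e) (hD : D.natDegree ≤ e + 1) (hD1 : D.coeff (e + 1) ≠ 0)
    (hA' : A'.natDegree ≤ e + 2) (hB' : B'.natDegree ≤ e + 1) (hC' : C''.natDegree ≤ e + 1)
    (hD' : D'.natDegree ≤ e + 2) (hδ : A * D - B * C' = ρ * δ) :
    (1 - X ^ 2) * (A * D - B * C') ≠ 0 ∧
    ((1 - X ^ 2) * (A * D - B * C')).natDegree = 2 * (e + 1) + 2 ∧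
    ((1 - X ^ 2) * derivative ρ * δ + B' * C' - A' * D).natDegree ≤ 2 * (e + 1) + 1 ∧
    ((1 - X ^ 2) * derivative ρ * δ + C'' * B - D' * A).natDegree ≤ 2 * (e + 1) + 1 ∧
    (C'' * D - D' * C').natDegree ≤ 2 * (e + 1) := by
  have hΔ1 : (A * D - B * C').coeff (2 * (e + 1)) ≠ 0 := by
    rw [coeff_sub, two_mul, coeff_mul_add_eq_of_natDegree_le hA hD, hA1, one_mul,
      coeff_eq_zero_of_natDegree_lt (p := B * C'), sub_zero]
    · exact hD1
    · exact (natDegree_mul_le_of_add_le hB hC le_rfl).trans_lt (by omega)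
  have hΔ0 : A * D - B * C' ≠ 0 := fun h => hΔ1 (by rw [h, coeff_zero])
  have hΔ : (A * D - B * C').natDegree = 2 * (e + 1) :=
    le_antisymm (natDegree_sub_le_of_both_le (natDegree_mul_le_of_add_le hA hD (by omega))
      (natDegree_mul_le_of_add_le hB hC (by omega))) (le_natDegree_of_ne_zero hΔ1)
  have hδd : δ.natDegree ≤ e + 1 := by
    have hδ0 : δ ≠ 0 := by
      rintro rfl
      exact hΔ0 (by rw [hδ, mul_zero])
    rw [hδ, hρm.natDegree_mul' hδ0] at hΔ
    omega
  have hw : (1 - X ^ 2 : ℝ[X]).natDegree = 2 := by compute_degree!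
  have hw0 : (1 - X ^ 2 : ℝ[X]) ≠ 0 := fun h => by simp [h] at hw
  have hρδ : ((1 - X ^ 2) * derivative ρ * δ).natDegree ≤ 2 * (e + 1) + 1 :=
    natDegree_mul_le_of_add_le
      (natDegree_mul_le_of_add_le hw.le (natDegree_derivative_le_pred hρ.le) le_rfl) hδd (by omega)
  refine ⟨mul_ne_zero hw0 hΔ0, by rw [natDegree_mul hw0 hΔ0, hw, hΔ, add_comm], ?_, ?_, ?_⟩
  · exact natDegree_sub_le_of_both_le (natDegree_add_le_of_degree_le hρδ
      (natDegree_mul_le_of_add_le hB' hC (by omega)))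
      (natDegree_mul_le_of_add_le hA' hD (by omega))
  · exact natDegree_sub_le_of_both_le (natDegree_add_le_of_degree_le hρδ
      (natDegree_mul_le_of_add_le hC' hB (by omega)))
      (natDegree_mul_le_of_add_le hD' hA (by omega))
  · exact natDegree_sub_le_of_both_le (natDegree_mul_le_of_add_le hC' hD (by omega))
      (natDegree_mul_le_of_add_le hD' hC (by omega))

end HolonomicEquation

theorem stmt15 (α β : ℝ) (hα : -1 < α) (hβ : -1 < β)
    (N : ℕ) (hN : 1 ≤ N)
    (c : Fin N → ℝ) (hc : Function.Injective c) (hcout : ∀ j, c j ∉ Set.Ioo (-1 : ℝ) 1)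
    (dd : Fin N → ℕ) (hdd : Monotone dd)
    (lam : Fin N → ℕ → ℝ) (hlam : ∀ j k, 0 ≤ lam j k) (hlamd : ∀ j, 0 < lam j (dd j))
    (d : ℕ) (hd : d = ∑ j, (dd j + 1))
    (P : ℕ → Polynomial ℝ) (hPm : ∀ m, (P m).Monic) (hPd : ∀ m, (P m).natDegree = m)
    (hPo : ∀ m l, m ≠ l → ∫ x, (P m).eval x * (P l).eval x ∂(jacobiMeasure α β) = 0)
    (h : ℕ → ℝ) (hh : ∀ m, h m = ∫ x, ((P m).eval x) ^ 2 ∂(jacobiMeasure α β))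
    (S : ℕ → Polynomial ℝ) (hSm : ∀ m, (S m).Monic) (hSd : ∀ m, (S m).natDegree = m)
    (hSo : ∀ m l, l < m → sobolevIP α β c dd lam (X ^ l) (S m) = 0)
    (A2 B2 : ℕ → Polynomial ℝ)
    (hA2 : ∀ m, 1 ≤ m → A2 m = rhoPoly c dd -
      ∑ j : Fin N, ∑ k ∈ Finset.range (dd j + 1),
        Polynomial.C ((Nat.factorial k : ℝ) * lam j k * (iterDeriv k (S m)).eval (c j) / h (m - 1)) *
          (taylorPoly k (c j) (P (m - 1)) * rhoJK c dd j k))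
    (hB2 : ∀ m, 1 ≤ m → B2 m =
      ∑ j : Fin N, ∑ k ∈ Finset.range (dd j + 1),
        Polynomial.C ((Nat.factorial k : ℝ) * lam j k * (iterDeriv k (S m)).eval (c j) / h (m - 1)) *
          (taylorPoly k (c j) (P m) * rhoJK c dd j k))
    (A3 B3 : ℕ → Polynomial ℝ)
    (hA3 : ∀ m, 1 ≤ m → A3 m = (1 - X ^ 2) * Polynomial.derivative (A2 m) +
      ahat α β m * A2 m + Polynomial.C (dhat α β m) * B2 m)
    (hB3 : ∀ m, 1 ≤ m → B3 m = (1 - X ^ 2) * Polynomial.derivative (B2 m) +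
      Polynomial.C (bhat α β m) * A2 m + chat α β m * B2 m)
    (hrec : ∀ m, 1 ≤ m → X * P m =
      P (m + 1) + Polynomial.C (gamma1 α β m) * P m + Polynomial.C (gamma2 α β m) * P (m - 1))
    (C2 D2 : ℕ → Polynomial ℝ)
    (hC2 : ∀ m, 2 ≤ m → C2 m = Polynomial.C (-(1 / gamma2 α β (m - 1))) * B2 (m - 1))
    (hD2 : ∀ m, 2 ≤ m → D2 m = A2 (m - 1) +
      Polynomial.C (1 / gamma2 α β (m - 1)) * B2 (m - 1) * (X - Polynomial.C (gamma1 α β (m - 1))))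
    (C3 D3 : ℕ → Polynomial ℝ)
    (hC3 : ∀ m, 2 ≤ m → C3 m = Polynomial.C (-(1 / gamma2 α β (m - 1))) * B3 (m - 1))
    (hD3 : ∀ m, 2 ≤ m → D3 m = A3 (m - 1) +
      Polynomial.C (1 / gamma2 α β (m - 1)) * B3 (m - 1) * (X - Polynomial.C (gamma1 α β (m - 1))))
    (δ : ℕ → Polynomial ℝ)
    (hδ : ∀ m, 2 ≤ m → A2 m * D2 m - B2 m * C2 m = rhoPoly c dd * δ m)
    (q0 : ℕ → Polynomial ℝ)
    (hq0 : ∀ m, 2 ≤ m → q0 m = (1 - X ^ 2) * (A2 m * D2 m - B2 m * C2 m))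
    (q1 q2 : ℕ → Polynomial ℝ)
    (hq1 : ∀ m, 1 ≤ m → q1 m = B3 m * A2 m - A3 m * B2 m)
    (hq2 : ∀ m, 2 ≤ m → q2 m = (1 - X ^ 2) * Polynomial.derivative (rhoPoly c dd) * δ m +
      B3 m * C2 m - A3 m * D2 m)
    (q3 q4 : ℕ → Polynomial ℝ)
    (hq3 : ∀ m, 2 ≤ m → q3 m = (1 - X ^ 2) * Polynomial.derivative (rhoPoly c dd) * δ m +
      C3 m * B2 m - D3 m * A2 m)
    (hq4 : ∀ m, 2 ≤ m → q4 m = C3 m * D2 m - D3 m * C2 m)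
    (PP0 PP1 PP2 : ℕ → Polynomial ℝ)
    (hPP2 : ∀ m, 2 ≤ m → PP2 m = q1 m * (q0 m) ^ 2)
    (hPP1 : ∀ m, 2 ≤ m → PP1 m = q0 m *
      (q1 m * q2 m + q1 m * q3 m + Polynomial.derivative (q0 m) * q1 m -
        q0 m * Polynomial.derivative (q1 m)))
    (hPP0 : ∀ m, 2 ≤ m → PP0 m = q1 m * q2 m * q3 m +
      q0 m * (Polynomial.derivative (q2 m) * q1 m - q2 m * Polynomial.derivative (q1 m)) -
      q4 m * (q1 m) ^ 2)
    (n : ℕ) (hn : 2 ≤ n) :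
    PP2 n * Polynomial.derivative (Polynomial.derivative (S n)) +
        PP1 n * Polynomial.derivative (S n) + PP0 n * S n = 0 ∧
      (d + 1 ≤ n → (PP2 n).natDegree = 6 * d + 4 ∧ (PP1 n).natDegree ≤ 6 * d + 3 ∧
        (PP0 n).natDegree ≤ 6 * d + 2) := by
  set L := jacobiFunctional hα hβ with hL
  have hP : IsMonicOrthogonal L P := by
    refine ⟨hPm, hPd, fun f hf => jacobiFunctional_mul_self_pos hα hβ hf, fun m l hml => ?_⟩
    simpa [hL, jacobiFunctional_apply] using hPo m l hml
  have hη : ∀ m, h m = L (P m * P m) := fun m => by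
    simp [hL, jacobiFunctional_apply, hh, sq]
  have pearson := jacobiFunctional_pearson hα hβ
  have hS : ∀ m : ℕ, ∀ f : ℝ[X], f.degree < m → sobolevFunctional c dd lam L (S m) f = 0 := by
    intro m f hf
    refine mem_submodule_of_degree_lt monic_X_pow natDegree_X_pow
      (LinearMap.ker (sobolevFunctional c dd lam L (S m))) (fun l hl => ?_) hf
    rw [LinearMap.mem_ker, sobolevFunctional_apply, ← hSo m l hl, sobolevIP, hL,
      jacobiFunctional_apply]
    simp only [evalDeriv_apply, eval_mul, mul_right_comm]
  have hA2' : ∀ m, 1 ≤ m → A2 m =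
      rhoPoly c dd - sobolevCorrection c dd lam (L (P (m - 1) * P (m - 1))) (S m) (P (m - 1)) :=
    fun m hm => by rw [hA2 m hm, hη]; rfl
  have hB2' : ∀ m, 1 ≤ m → B2 m =
      sobolevCorrection c dd lam (L (P (m - 1) * P (m - 1))) (S m) (P m) :=
    fun m hm => by rw [hB2 m hm, hη]; rfl
  have connection : ∀ m, 1 ≤ m → rhoPoly c dd * S m = A2 m * P m + B2 m * P (m - 1) :=
    fun m hm => by
      rw [hA2' m hm, hB2' m hm]
      exact hP.connection_formula c dd lam hrec (hSm m) (hSd m) hm (hS m)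
  have derived : ∀ m, 1 ≤ m →
      (1 - X ^ 2) * derivative (rhoPoly c dd * S m) = A3 m * P m + B3 m * P (m - 1) := by
    intro m hm
    have h1 := hP.jacobi_structure hα hβ pearson hrec hm
    have h2 := hP.jacobi_structure_pred hα hβ pearson hrec hm
    rw [connection m hm, hA3 m hm, hB3 m hm]
    simp only [derivative_add, derivative_mul]
    linear_combination A2 m * h1 + B2 m * h2
  have hγ : ∀ m, 1 ≤ m → 0 < gamma2 α β m := fun m hm => by
    have h1 := hP.norm_pos m
    rw [hP.norm_eq hm (hrec m hm)] at h1
    exact pos_of_mul_pos_left h1 (hP.norm_pos (m - 1)).le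
  obtain ⟨k, rfl⟩ : ∃ k, n = k + 2 := ⟨n - 2, by omega⟩
  have hγk := hγ (k + 1) (by omega)
  have hCγ : C (1 / gamma2 α β (k + 1)) * C (gamma2 α β (k + 1)) = 1 := by
    rw [← C_mul, one_div_mul_cancel hγk.ne', C_1]
  have hneg : C (-(1 / gamma2 α β (k + 1))) = -C (1 / gamma2 α β (k + 1)) := C_neg
  have hreck := hrec (k + 1) (by omega)
  have connection' : rhoPoly c dd * S (k + 1) = C2 (k + 2) * P (k + 2) + D2 (k + 2) * P (k + 1) := by
    rw [connection (k + 1) (by omega), hC2 _ hn, hD2 _ hn]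
    simp only [Nat.add_sub_cancel, Nat.reduceSubDiff, hneg] at hreck ⊢
    linear_combination B2 (k + 1) * (-P k * hCγ - C (1 / gamma2 α β (k + 1)) * hreck)
  have derived' : (1 - X ^ 2) * derivative (rhoPoly c dd * S (k + 1)) =
      C3 (k + 2) * P (k + 2) + D3 (k + 2) * P (k + 1) := by
    rw [derived (k + 1) (by omega), hC3 _ hn, hD3 _ hn]
    simp only [Nat.add_sub_cancel, Nat.reduceSubDiff, hneg] at hreck ⊢
    linear_combination B3 (k + 1) * (-P k * hCγ - C (1 / gamma2 α β (k + 1)) * hreck)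
  have hδk := hδ _ hn
  rw [hPP2 _ hn, hPP1 _ hn, hPP0 _ hn]
  constructor
  · refine holonomic_of_ladder (T := S (k + 1)) ?_ ?_
    · rw [hq0 _ hn, hq1 _ (by omega), hq2 _ hn]
      exact ladder_equation (rhoPoly_monic c dd).ne_zero (connection (k + 2) (by omega))
        connection' (derived (k + 2) (by omega)) hδk
    · have hδk' : D2 (k + 2) * A2 (k + 2) - C2 (k + 2) * B2 (k + 2) = rhoPoly c dd * δ (k + 2) := by
        rw [← hδk]; ring
      have := ladder_equation (rhoPoly_monic c dd).ne_zero
        (connection'.trans (add_comm _ _)) ((connection (k + 2) (by omega)).trans (add_comm _ _))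
        (derived'.trans (add_comm _ _)) hδk'
      rw [hq0 _ hn, hq3 _ hn, hq4 _ hn]
      linear_combination this
  · intro _
    obtain ⟨e, he⟩ : ∃ e, ∑ j, (dd j + 1) = e + 1 := by
      have : dd ⟨0, hN⟩ + 1 ≤ ∑ j, (dd j + 1) :=
        Finset.single_le_sum (f := fun j => dd j + 1) (fun _ _ => Nat.zero_le _)
          (Finset.mem_univ _)
      exact ⟨∑ j, (dd j + 1) - 1, by omega⟩
    have hρ := (rhoPoly_natDegree c dd).trans he
    rw [he] at hd
    subst hd
    have hB : ∀ m, 1 ≤ m → (B2 m).natDegree ≤ e := fun m hm => by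
      rw [hB2' m hm]
      exact natDegree_sobolevCorrection_le c dd lam he _ _ _
    have hA : ∀ m, 1 ≤ m → (A2 m).natDegree ≤ e + 1 := fun m hm => by
      rw [hA2' m hm]
      exact natDegree_sub_le_of_both_le hρ.le
        ((natDegree_sobolevCorrection_le c dd lam he _ _ _).trans (by omega))
    have hA1 : ∀ m, 1 ≤ m → (A2 m).coeff (e + 1) = 1 := fun m hm => by
      have h1 := (rhoPoly_monic c dd).coeff_natDegree
      rw [hρ] at h1
      rw [hA2' m hm, coeff_sub, h1, coeff_eq_zero_of_natDegree_lt, sub_zero]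
      exact (natDegree_sobolevCorrection_le c dd lam he _ _ _).trans_lt (by omega)
    have hA' : ∀ m, 1 ≤ m → (A3 m).natDegree ≤ e + 2 := fun m hm => by
      rw [hA3 m hm]
      exact natDegree_derivedA_le (hA m hm) (hB m hm)
    have hB' : ∀ m, 1 ≤ m → (B3 m).natDegree ≤ e + 1 := fun m hm => by
      rw [hB3 m hm]
      exact natDegree_derivedB_le (hA m hm) (hB m hm)
    have hpos : ∀ m, 1 ≤ m → 0 < gamma2 α β m + (B2 m).coeff e := fun m hm => by
      have h1 := hP.norm_add_coeff_pos c dd lam hlam he (hSm m) (hSd m) (hS m)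
        (hP.norm_pos (m - 1))
      rwa [← hB2' m hm, hP.norm_eq hm (hrec m hm),
        mul_div_cancel_right₀ _ (hP.norm_pos (m - 1)).ne'] at h1
    have hX : ∀ r : ℝ, (X - C r).natDegree ≤ 1 := fun r => (natDegree_X_sub_C r).le
    have hC : (C2 (k + 2)).natDegree ≤ e := by
      rw [hC2 _ hn]
      exact (natDegree_C_mul_le _ _).trans (hB _ (by omega))
    have hC' : (C3 (k + 2)).natDegree ≤ e + 1 := by
      rw [hC3 _ hn]
      exact (natDegree_C_mul_le _ _).trans (hB' _ (by omega))
    have hD : (D2 (k + 2)).natDegree ≤ e + 1 := by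
      rw [hD2 _ hn]
      exact natDegree_add_le_of_degree_le (hA _ (by omega)) (natDegree_mul_le_of_add_le
        ((natDegree_C_mul_le _ _).trans (hB _ (by omega))) (hX _) le_rfl)
    have hD' : (D3 (k + 2)).natDegree ≤ e + 2 := by
      rw [hD3 _ hn]
      exact natDegree_add_le_of_degree_le (hA' _ (by omega)) (natDegree_mul_le_of_add_le
        ((natDegree_C_mul_le _ _).trans (hB' _ (by omega))) (hX _) le_rfl)
    have hD1 : (D2 (k + 2)).coeff (e + 1) ≠ 0 := by
      have h1 := hpos (k + 1) (by omega)
      have h2 : (D2 (k + 2)).coeff (e + 1) =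
          1 + 1 / gamma2 α β (k + 1) * (B2 (k + 1)).coeff e := by
        rw [hD2 _ hn, coeff_add, hA1 _ (by omega), mul_assoc, coeff_C_mul,
          coeff_mul_add_eq_of_natDegree_le (hB _ (by omega)) (hX _)]
        simp [coeff_X]
      have h3 : gamma2 α β (k + 1) * (D2 (k + 2)).coeff (e + 1) =
          gamma2 α β (k + 1) + (B2 (k + 1)).coeff e := by
        rw [h2]
        field_simp
      exact right_ne_zero_of_mul (h3.trans_ne h1.ne')
    have hq1c : (q1 (k + 2)).coeff (2 * (e + 1)) ≠ 0 := by
      have hs : 0 < 2 * ((k + 2 : ℕ) : ℝ) + α + β := by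
        push_cast
        linarith [(Nat.cast_nonneg k : (0 : ℝ) ≤ k)]
      rw [hq1 _ (by omega), hB3 _ (by omega), hA3 _ (by omega), mul_add,
        coeff_derived_det hs.ne' (by linarith) (hA _ (by omega)) (hA1 _ (by omega))
          (hB _ (by omega))]
      exact (mul_pos (by linarith) (hpos _ (by omega))).ne'
    have hq1d : (q1 (k + 2)).natDegree = 2 * (e + 1) := by
      refine le_antisymm ?_ (le_natDegree_of_ne_zero hq1c)
      rw [hq1 _ (by omega)]
      exact natDegree_sub_le_of_both_le
        (natDegree_mul_le_of_add_le (hB' _ (by omega)) (hA _ (by omega)) (by omega))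
        (natDegree_mul_le_of_add_le (hA' _ (by omega)) (hB _ (by omega)) (by omega))
    obtain ⟨h0, h0d, h2d, h3d, h4d⟩ := natDegree_ladder_coefficients (rhoPoly_monic c dd) hρ
      (hA (k + 2) (by omega)) (hA1 (k + 2) (by omega)) (hB (k + 2) (by omega)) hC hD hD1 (hA' (k + 2) (by omega))
      (hB' (k + 2) (by omega)) hC' hD' hδk
    rw [← hq0 _ hn] at h0 h0d
    rw [← hq2 _ hn] at h2d
    rw [← hq3 _ hn] at h3d
    rw [← hq4 _ hn] at h4d
    exact natDegree_holonomic_coefficients h0d h0 hq1d (fun h => hq1c (by rw [h, coeff_zero]))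
      h2d h3d h4d (by omega)
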